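/- arXiv:2103.11379 — 2 statements merged into one kernel-verified Lean document; each statement's English description precedes it below -/
import Mathlib

section
/- The error propagation matrix E intertwines the assembled block matrices: E · 𝐑̃^⊤ = 𝐑̃^⊤ · 𝐓, where 𝐓 := (𝐑 − 𝐐) 𝐑̃^⊤. -/
open Matrix

/-- The product of a block row and a block column is the sum of the products of their blocks. -/
theorem Matrix.mul_eq_sum_of_sigma_blocks {ι m n α : Type*} {κ : ι → Type*}
    [Fintype ι] [∀ i, Fintype (κ i)] [NonUnitalNonAssocSemiring α]
    {X : Matrix m (Σ i, κ i) α} {Y : Matrix (Σ i, κ i) n α}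
    {x : ∀ i, Matrix m (κ i) α} {y : ∀ i, Matrix (κ i) n α}
    (hX : ∀ p i q, X p ⟨i, q⟩ = x i p q) (hY : ∀ i q p, Y ⟨i, q⟩ p = y i q p) :
    X * Y = ∑ i, x i * y i := by
  ext a b
  simp [Matrix.mul_apply, Matrix.sum_apply, Fintype.sum_sigma, hX, hY]

/-- The ORAS error propagation matrix `E = I − B⁻¹A` intertwines the assembled block
matrices: `E 𝐑̃ᵀ = 𝐑̃ᵀ 𝐓`, where `𝐓 = (𝐑 − 𝐐) 𝐑̃ᵀ`. -/
theorem oras_intertwining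
    (N M : ℕ) (hN : 0 < N) (hM : 0 < M)
    (Mloc : Fin N → ℕ) (hMloc : ∀ ℓ, 0 < Mloc ℓ)
    (A : Matrix (Fin M) (Fin M) ℂ)
    (Aloc : ∀ ℓ : Fin N, Matrix (Fin (Mloc ℓ)) (Fin (Mloc ℓ)) ℂ)
    (hAloc : ∀ ℓ, IsUnit (Aloc ℓ))
    (R Rt : ∀ ℓ : Fin N, Matrix (Fin (Mloc ℓ)) (Fin M) ℂ)
    (hPOU : ∑ ℓ, (Rt ℓ)ᵀ * R ℓ = (1 : Matrix (Fin M) (Fin M) ℂ))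
    (bigR bigQ : Matrix (Σ ℓ : Fin N, Fin (Mloc ℓ)) (Fin M) ℂ)
    (bigRt : Matrix (Fin M) (Σ ℓ : Fin N, Fin (Mloc ℓ)) ℂ)
    (hbigR : ∀ (ℓ : Fin N) (q : Fin (Mloc ℓ)) (p : Fin M), bigR ⟨ℓ, q⟩ p = R ℓ q p)
    (hbigQ : ∀ (ℓ : Fin N) (q : Fin (Mloc ℓ)) (p : Fin M),
      bigQ ⟨ℓ, q⟩ p = ((Aloc ℓ)⁻¹ * R ℓ * A) q p)
    (hbigRt : ∀ (p : Fin M) (ℓ : Fin N) (q : Fin (Mloc ℓ)), bigRt p ⟨ℓ, q⟩ = (Rt ℓ)ᵀ p q) :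
    ((1 : Matrix (Fin M) (Fin M) ℂ) - (∑ ℓ, (Rt ℓ)ᵀ * (Aloc ℓ)⁻¹ * R ℓ) * A) * bigRt
      = bigRt * ((bigR - bigQ) * bigRt) := by
  have hR : bigRt * bigR = 1 :=
    (Matrix.mul_eq_sum_of_sigma_blocks hbigRt hbigR).trans hPOU
  have hQ : bigRt * bigQ = (∑ ℓ, (Rt ℓ)ᵀ * (Aloc ℓ)⁻¹ * R ℓ) * A := by
    rw [Matrix.mul_eq_sum_of_sigma_blocks hbigRt hbigQ, Matrix.sum_mul]
    simp only [Matrix.mul_assoc]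
  rw [← Matrix.mul_assoc, Matrix.mul_sub, hR, hQ]
end

section
/- For every integer s ≥ 1, the s-th power of the ORAS error propagation matrix satisfies E^s = 𝐑̃^⊤ 𝐓^s 𝐑, where 𝐓 := (𝐑 − 𝐐) 𝐑̃^⊤. -/
open Matrix

/-- The product of a block row and a block column is the sum of the products of the blocks. -/
theorem Matrix.mul_eq_sum_of_blocks {ι m n α : Type*} {k : ι → Type*} [Fintype ι]
    [∀ i, Fintype (k i)] [NonUnitalNonAssocSemiring α]
    {P : Matrix m (Σ i, k i) α} {D : Matrix (Σ i, k i) n α}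
    {p : ∀ i, Matrix m (k i) α} {d : ∀ i, Matrix (k i) n α}
    (hP : ∀ a i q, P a ⟨i, q⟩ = p i a q) (hD : ∀ i q b, D ⟨i, q⟩ b = d i q b) :
    P * D = ∑ i, p i * d i := by
  ext a b
  simp only [mul_apply, sum_apply, Fintype.sum_sigma, hP, hD]

/-- Push-through identity for powers of products of rectangular matrices. -/
theorem Matrix.mul_pow_mul_comm {m n α : Type*} [Fintype m] [Fintype n] [DecidableEq m]
    [DecidableEq n] [Semiring α] (P : Matrix m n α) (D : Matrix n m α) (s : ℕ) :
    P * (D * P) ^ s = (P * D) ^ s * P := by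
  induction s with
  | zero => simp
  | succ s ih => rw [pow_succ, ← Matrix.mul_assoc, ih, pow_succ]; simp only [Matrix.mul_assoc]

/-- For every integer `s ≥ 1`, the s-th power of the ORAS error propagation matrix
`E = I − B⁻¹A` satisfies `E^s = 𝐑̃ᵀ 𝐓^s 𝐑`, where `𝐓 = (𝐑 − 𝐐) 𝐑̃ᵀ`. -/
theorem oras_power_formula
    (N M : ℕ) (hN : 0 < N) (hM : 0 < M)
    (Mloc : Fin N → ℕ) (hMloc : ∀ ℓ, 0 < Mloc ℓ)
    (A : Matrix (Fin M) (Fin M) ℂ)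
    (Aloc : ∀ ℓ : Fin N, Matrix (Fin (Mloc ℓ)) (Fin (Mloc ℓ)) ℂ)
    (hAloc : ∀ ℓ, IsUnit (Aloc ℓ))
    (R Rt : ∀ ℓ : Fin N, Matrix (Fin (Mloc ℓ)) (Fin M) ℂ)
    (hPOU : ∑ ℓ, (Rt ℓ)ᵀ * R ℓ = (1 : Matrix (Fin M) (Fin M) ℂ))
    (bigR bigQ : Matrix (Σ ℓ : Fin N, Fin (Mloc ℓ)) (Fin M) ℂ)
    (bigRt : Matrix (Fin M) (Σ ℓ : Fin N, Fin (Mloc ℓ)) ℂ)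
    (hbigR : ∀ (ℓ : Fin N) (q : Fin (Mloc ℓ)) (p : Fin M), bigR ⟨ℓ, q⟩ p = R ℓ q p)
    (hbigQ : ∀ (ℓ : Fin N) (q : Fin (Mloc ℓ)) (p : Fin M),
      bigQ ⟨ℓ, q⟩ p = ((Aloc ℓ)⁻¹ * R ℓ * A) q p)
    (hbigRt : ∀ (p : Fin M) (ℓ : Fin N) (q : Fin (Mloc ℓ)), bigRt p ⟨ℓ, q⟩ = (Rt ℓ)ᵀ p q) :
    ∀ s : ℕ, 1 ≤ s →
      ((1 : Matrix (Fin M) (Fin M) ℂ) - (∑ ℓ, (Rt ℓ)ᵀ * (Aloc ℓ)⁻¹ * R ℓ) * A) ^ s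
        = bigRt * ((bigR - bigQ) * bigRt) ^ s * bigR := by
  intro s _
  have hR : bigRt * bigR = 1 := (mul_eq_sum_of_blocks hbigRt hbigR).trans hPOU
  have hE : bigRt * (bigR - bigQ) = 1 - (∑ ℓ, (Rt ℓ)ᵀ * (Aloc ℓ)⁻¹ * R ℓ) * A := by
    rw [Matrix.mul_sub, hR, mul_eq_sum_of_blocks hbigRt hbigQ, Matrix.sum_mul]
    simp only [Matrix.mul_assoc]
  rw [mul_pow_mul_comm, Matrix.mul_assoc, hR, Matrix.mul_one, hE]
end
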